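/- The number of partitions of a 16-element set into four 4-element blocks such that each block is a valid pure epistemic state of two toy bits is 105 when blocks range over all 4-element subsets (i.e., the number of partitions of a 16-set into four 4-subsets each of which is one of the 60 valid pure epistemic states is 105). -/

import Mathlib

/-- `s` is a valid pure epistemic state of two toy bits: either an uncorrelated
product `e_{ab} × e_{cd}` of single-bit pure states, or the graph `{(i, P i)}` of a
permutation `P ∈ S₄`. -/
def IsValidPure (s : Finset (Fin 4 × Fin 4)) : Prop :=
  (∃ a b c d : Fin 4, a ≠ b ∧ c ≠ d ∧
      s = ({a, b} : Finset (Fin 4)) ×ˢ ({c, d} : Finset (Fin 4))) ∨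
  ∃ P : Equiv.Perm (Fin 4), s = Finset.univ.image (fun i => (i, P i))

/-- The ontic state set encoded by a 16-bit mask. -/
def dec (m : ℕ) : Finset (Fin 4 × Fin 4) :=
  Finset.univ.filter (fun p => m.testBit (4 * p.1.val + p.2.val) = true)

/-- Masks of product states. -/
def L1 : List ℕ := [51, 85, 102, 153, 170, 204, 771, 816, 1285, 1360, 1542, 1632, 2313, 2448,
  2570, 2720, 3084, 3264, 12291, 12336, 13056, 20485, 20560, 21760, 24582, 24672, 26112, 36873,
  37008, 39168, 40970, 41120, 43520, 49164, 49344, 52224]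

/-- Masks of permutation graphs. -/
def L2 : List ℕ := [4680, 4740, 5160, 5250, 6180, 6210, 8520, 8580, 9240, 9345, 10260, 10305,
  16680, 16770, 16920, 17025, 18450, 18465, 33060, 33090, 33300, 33345, 33810, 33825]

def LL : List ℕ := L1 ++ L2

def prodMask (a b c d : Fin 4) : ℕ :=
  (2 ^ (4 * a.val) + 2 ^ (4 * b.val)) * (2 ^ c.val + 2 ^ d.val)

def permMask (P : Equiv.Perm (Fin 4)) : ℕ :=
  2 ^ (P 0).val + 2 ^ (4 + (P 1).val) + 2 ^ (8 + (P 2).val) + 2 ^ (12 + (P 3).val)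

theorem toyProd_mem : ∀ a b c d : Fin 4, a ≠ b → c ≠ d → prodMask a b c d ∈ L1 := by
  decide +kernel

theorem prod_dec : ∀ a b c d : Fin 4, a ≠ b → c ≠ d →
    dec (prodMask a b c d) = ({a, b} : Finset (Fin 4)) ×ˢ ({c, d} : Finset (Fin 4)) := by
  decide +kernel

theorem prod_surj : ∀ m ∈ L1, ∃ a b c d : Fin 4, a ≠ b ∧ c ≠ d ∧ prodMask a b c d = m := by
  decide +kernel

theorem perm_mem : ∀ P : Equiv.Perm (Fin 4), permMask P ∈ L2 := by
  decide +kernel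

theorem perm_dec : ∀ P : Equiv.Perm (Fin 4),
    dec (permMask P) = Finset.univ.image (fun i => (i, P i)) := by
  decide +kernel

theorem perm_surj : ∀ m ∈ L2, ∃ P : Equiv.Perm (Fin 4), permMask P = m := by
  decide +kernel

theorem LL_lt : ∀ m ∈ LL, m < 2 ^ 16 := by decide +kernel

theorem LL_nodup : LL.Nodup := by decide +kernel

theorem LL_card : ∀ m ∈ LL, (dec m).card = 4 := by decide +kernel

theorem valid_iff (s : Finset (Fin 4 × Fin 4)) :
    IsValidPure s ↔ s ∈ LL.toFinset.image dec := by
  simp only [Finset.mem_image, List.mem_toFinset, LL, List.mem_append]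
  constructor
  · rintro (⟨a, b, c, d, h1, h2, rfl⟩ | ⟨P, rfl⟩)
    · exact ⟨_, Or.inl (toyProd_mem a b c d h1 h2), prod_dec a b c d h1 h2⟩
    · exact ⟨_, Or.inr (perm_mem P), perm_dec P⟩
  · rintro ⟨m, h | h, rfl⟩
    · obtain ⟨a, b, c, d, h1, h2, rfl⟩ := prod_surj m h
      exact Or.inl ⟨a, b, c, d, h1, h2, prod_dec a b c d h1 h2⟩
    · obtain ⟨P, rfl⟩ := perm_surj m h
      exact Or.inr ⟨P, perm_dec P⟩

theorem mem_dec (m : ℕ) (p : Fin 4 × Fin 4) :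
    p ∈ dec m ↔ m.testBit (4 * p.1.val + p.2.val) = true := by
  simp [dec]

theorem dec_subset {m u : ℕ} (hm : m < 2 ^ 16) : dec m ⊆ dec u ↔ m &&& u = m := by
  constructor
  · intro h
    apply Nat.eq_of_testBit_eq
    intro i
    rw [Nat.testBit_and]
    by_cases hi : i < 16
    · have := @h (⟨i / 4, by omega⟩, ⟨i % 4, by omega⟩)
      simp only [mem_dec] at this
      rw [show 4 * (i / 4) + i % 4 = i by omega] at this
      cases h1 : m.testBit i
      · simp
      · simp [this h1]
    · rw [Nat.testBit_lt_two_pow (lt_of_lt_of_le hm (Nat.pow_le_pow_right (by norm_num) (by omega)))]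
      simp
  · intro h p hp
    rw [mem_dec] at hp ⊢
    rw [← h, Nat.testBit_and] at hp
    simp at hp
    exact hp.2

theorem dec_sdiff (m u : ℕ) : dec u \ dec m = dec (u ^^^ (u &&& m)) := by
  ext p
  simp only [Finset.mem_sdiff, mem_dec, Nat.testBit_xor, Nat.testBit_and]
  cases u.testBit (4 * p.1.val + p.2.val) <;> cases m.testBit (4 * p.1.val + p.2.val) <;> simp

theorem dec_inj : Set.InjOn dec (LL.toFinset : Set ℕ) := by
  intro m hm n hn h
  have hm' := LL_lt m (by simpa using hm)
  have hn' := LL_lt n (by simpa using hn)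
  have a := (dec_subset (u := n) hm').1 h.subset
  have b := (dec_subset (u := m) hn').1 h.symm.subset
  rw [Nat.land_comm] at b
  exact a.symm.trans b

section cover
variable {α : Type*} [DecidableEq α]

open Classical in
/-- Exact covers of `U` by members of `V`. -/
noncomputable def covers (V : Finset (Finset α)) (U : Finset α) : Finset (Finset (Finset α)) :=
  V.powerset.filter (fun F => (F : Set (Finset α)).PairwiseDisjoint id ∧ F.sup id = U)

theorem mem_covers {V : Finset (Finset α)} {U : Finset α} {F : Finset (Finset α)} :
    F ∈ covers V U ↔ F ⊆ V ∧ (F : Set (Finset α)).PairwiseDisjoint id ∧ F.sup id = U := by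
  simp [covers]

theorem mem_supid {F : Finset (Finset α)} {p : α} : p ∈ F.sup id ↔ ∃ s ∈ F, p ∈ s := by
  simp [Finset.mem_sup]

theorem covers_empty {V : Finset (Finset α)} (hV : ∅ ∉ V) : (covers V ∅).card = 1 := by
  rw [Finset.card_eq_one]
  refine ⟨∅, ?_⟩
  ext F
  rw [mem_covers, Finset.mem_singleton]
  constructor
  · rintro ⟨h1, -, h3⟩
    rw [Finset.eq_empty_iff_forall_notMem]
    intro s hs
    have : s ⊆ F.sup id := Finset.le_sup (f := id) hs
    rw [h3, Finset.subset_empty] at this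
    exact hV (this ▸ h1 hs)
  · rintro rfl
    simp

theorem covers_rec {V : Finset (Finset α)} {U : Finset α} {p : α} (hp : p ∈ U) :
    (covers V U).card =
      ∑ s ∈ V.filter (fun s => p ∈ s ∧ s ⊆ U), (covers V (U \ s)).card := by
  have key : covers V U = (V.filter (fun s => p ∈ s ∧ s ⊆ U)).biUnion
      (fun s => (covers V (U \ s)).image (insert s)) := by
    ext F
    simp only [Finset.mem_biUnion, Finset.mem_filter, Finset.mem_image]
    constructor
    · intro hF
      obtain ⟨h1, h2, h3⟩ := mem_covers.1 hF
      have hp' := hp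
      rw [← h3, mem_supid] at hp'
      obtain ⟨s, hs, hps⟩ := hp'
      have hsU : s ⊆ U := h3 ▸ Finset.le_sup (f := id) hs
      refine ⟨s, ⟨h1 hs, hps, hsU⟩, F.erase s, ?_, Finset.insert_erase hs⟩
      rw [mem_covers]
      refine ⟨(Finset.erase_subset _ _).trans h1, h2.subset (by simp), ?_⟩
      ext q
      rw [mem_supid, Finset.mem_sdiff, ← h3, mem_supid]
      constructor
      · rintro ⟨t, ht, hq⟩
        rw [Finset.mem_erase] at ht
        refine ⟨⟨t, ht.2, hq⟩, fun hqs => ?_⟩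
        exact Finset.disjoint_left.1 (h2 ht.2 hs ht.1) hq hqs
      · rintro ⟨⟨t, ht, hq⟩, hqs⟩
        refine ⟨t, Finset.mem_erase.2 ⟨?_, ht⟩, hq⟩
        rintro rfl
        exact hqs hq
    · rintro ⟨s, ⟨hsV, hps, hsU⟩, G, hG, rfl⟩
      obtain ⟨h1, h2, h3⟩ := mem_covers.1 hG
      rw [mem_covers]
      refine ⟨Finset.insert_subset hsV h1, ?_, ?_⟩
      · rw [Finset.coe_insert]
        refine h2.insert ?_
        intro t ht _
        have : t ⊆ U \ s := h3 ▸ Finset.le_sup (f := id) ht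
        exact (Finset.disjoint_of_subset_left this Finset.sdiff_disjoint).symm
      · rw [Finset.sup_insert, h3]
        exact Finset.union_sdiff_of_subset hsU
  have hnot : ∀ s, p ∈ s → ∀ G ∈ covers V (U \ s), ∀ t ∈ G, p ∉ t := by
    intro s hps G hG t ht hpt
    obtain ⟨h1, h2, h3⟩ := mem_covers.1 hG
    have : p ∈ U \ s := h3 ▸ mem_supid.2 ⟨t, ht, hpt⟩
    exact (Finset.mem_sdiff.1 this).2 hps
  rw [key, Finset.card_biUnion]
  · apply Finset.sum_congr rfl
    intro s hs
    have hps := (Finset.mem_filter.1 hs).2.1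
    apply Finset.card_image_of_injOn
    intro G hG H hH hGH
    have a : s ∉ G := fun h => hnot s hps G hG s h hps
    have b : s ∉ H := fun h => hnot s hps H hH s h hps
    have := congrArg (fun F => Finset.erase F s) hGH
    simpa [Finset.erase_insert a, Finset.erase_insert b] using this
  · intro s hs t ht hst
    have hps := (Finset.mem_filter.1 hs).2.1
    have hpt := (Finset.mem_filter.1 ht).2.1
    refine Finset.disjoint_left.2 ?_
    intro F hF hF'
    obtain ⟨G, hG, rfl⟩ := Finset.mem_image.1 hF
    obtain ⟨H, hH, hGH⟩ := Finset.mem_image.1 hF'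
    have : s ∈ insert t H := hGH ▸ Finset.mem_insert_self s G
    rcases Finset.mem_insert.1 this with h | h
    · exact hst h
    · exact hnot t hpt H hH s h hps

end cover

/-- Points listed for branching. -/
def pts : List (Fin 4 × Fin 4) :=
  (List.finRange 4).flatMap (fun i => (List.finRange 4).map (fun j => (i, j)))

theorem mem_pts : ∀ p, p ∈ pts := by decide +kernel

/-- Exact cover search on masks. -/
def search : ℕ → ℕ → Option ℕ
  | 0, u => if u = 0 then some 1 else none
  | n + 1, u =>
    match pts.find? (fun p => u.testBit (4 * p.1.val + p.2.val)) with
    | none => some 1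
    | some p =>
      (LL.filter (fun m => m.testBit (4 * p.1.val + p.2.val) && (m &&& u == m))).foldr
        (fun m acc => (search n (u ^^^ (u &&& m))).bind fun x => acc.map fun y => x + y) (some 0)

theorem foldr_opt (f : ℕ → Option ℕ) (g : ℕ → ℕ) (l : List ℕ)
    (h : ∀ m ∈ l, ∀ x, f m = some x → g m = x) (k : ℕ)
    (hk : l.foldr (fun m acc => (f m).bind fun x => acc.map fun y => x + y) (some 0) = some k) :
    (l.map g).sum = k := by
  induction l generalizing k with
  | nil => simpa using hk
  | cons m l ih =>
    simp only [List.foldr_cons, Option.bind_eq_some_iff, Option.map_eq_some_iff] at hk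
    obtain ⟨x, hx, y, hy, rfl⟩ := hk
    rw [List.map_cons, List.sum_cons, h m (by simp) x hx,
      ih (fun m hm => h m (by simp [hm])) y hy]

theorem empty_notMem : ∅ ∉ LL.toFinset.image dec := by
  intro h
  obtain ⟨m, hm, h⟩ := Finset.mem_image.1 h
  have := LL_card m (by simpa using hm)
  rw [h] at this
  simp at this

theorem search_sound (n : ℕ) : ∀ u k, search n u = some k →
    (covers (LL.toFinset.image dec) (dec u)).card = k := by
  induction n with
  | zero =>
    intro u k h
    simp only [search] at h
    split_ifs at h with hu
    subst hu
    have : dec 0 = ∅ := by simp [dec]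
    rw [this, covers_empty empty_notMem]
    simpa using h
  | succ n ih =>
    intro u k h
    rw [search] at h
    split at h
    · rename_i hf
      have : dec u = ∅ := by
        rw [Finset.eq_empty_iff_forall_notMem]
        intro p hp
        rw [mem_dec] at hp
        exact (List.find?_eq_none.1 hf) p (mem_pts p) hp
      rw [this, covers_empty empty_notMem]
      simpa using h
    · rename_i p hf
      have hp : p ∈ dec u := by
        rw [mem_dec]
        simpa using List.find?_some hf
      have := foldr_opt _ (fun m => (covers (LL.toFinset.image dec) (dec u \ dec m)).card) _
        (fun m _ x hx => by
          show Finset.card (covers _ (dec u \ dec m)) = x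
          rw [dec_sdiff]; exact ih _ _ hx) k h
      rw [← this, covers_rec hp, ← List.sum_toFinset _ (LL_nodup.filter _),
        Finset.filter_image, Finset.sum_image]
      · apply Finset.sum_congr _ (fun _ _ => rfl)
        ext m
        simp only [Finset.mem_filter, List.mem_toFinset, List.mem_filter, Bool.and_eq_true,
          beq_iff_eq, mem_dec]
        refine and_congr_right fun hm => ?_
        rw [dec_subset (LL_lt m hm)]
      · intro a ha b hb hab
        exact dec_inj (Finset.mem_filter.1 ha).1 (Finset.mem_filter.1 hb).1 hab

theorem search_val : search 4 65535 = some 105 := by decide +kernel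

theorem dec_full : dec 65535 = Finset.univ := by decide +kernel

theorem covers_card4 {F : Finset (Finset (Fin 4 × Fin 4))}
    (hF : F ∈ covers (LL.toFinset.image dec) Finset.univ) : F.card = 4 := by
  obtain ⟨h1, h2, h3⟩ := mem_covers.1 hF
  have h : (F.sup id).card = ∑ s ∈ F, s.card := by
    rw [Finset.sup_eq_biUnion, Finset.card_biUnion (fun s hs t ht hst => h2 hs ht hst)]
    rfl
  rw [h3, Finset.sum_congr rfl (g := fun _ => 4)] at h
  · simp at h
    omega
  · intro s hs
    obtain ⟨m, hm, rfl⟩ := Finset.mem_image.1 (h1 hs)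
    exact LL_card m (by simpa using hm)

/-- The number of partitions of the 16 ontic states of two toy bits into four
disjoint blocks, each a valid pure epistemic state, is 105. -/
theorem stmt_19 :
    Nat.card {F : Finset (Finset (Fin 4 × Fin 4)) //
      F.card = 4 ∧ (∀ s ∈ F, IsValidPure s) ∧
      (F : Set (Finset (Fin 4 × Fin 4))).PairwiseDisjoint id ∧
      F.sup id = Finset.univ} = 105 := by
  have e := search_sound 4 65535 105 search_val
  rw [dec_full] at e
  rw [← e, ← Nat.card_eq_finsetCard]
  apply Nat.card_congr
  apply Equiv.subtypeEquivRight
  intro F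
  constructor
  · rintro ⟨_, h1, h2, h3⟩
    exact mem_covers.2 ⟨fun s hs => (valid_iff s).1 (h1 s hs), h2, h3⟩
  · intro hF
    obtain ⟨h1, h2, h3⟩ := mem_covers.1 hF
    exact ⟨covers_card4 hF, fun s hs => (valid_iff s).2 (h1 hs), h2, h3⟩
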